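/- arXiv:1106.3948 — 5 statements merged into one kernel-verified Lean document; each statement's English description precedes it below -/
import Mathlib

section
/- For every complex number q with |q| < 1 (equivalently, as an identity of formal power series in q), the following identity of Ramanujan holds: ∑_{k=0}^∞ (−1)^k q^{k(k+1)/2} = (∏_{j=1}^∞ (1−q^j))^2 · ∑_{k=0}^∞ q^k / (∏_{j=1}^k (1−q^j))^2. -/
open Filter Topology

/-- The finite `q`-Pochhammer symbol `(q; q)_n`. -/
noncomputable def qFactor (q : ℂ) (n : ℕ) : ℂ := ∏ j ∈ Finset.range n, (1 - q ^ (j + 1))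

/-- The summands `q ^ n / (q; q)_n` of Euler's series. -/
noncomputable def eulerTerm (q : ℂ) (n : ℕ) : ℂ := q ^ n / qFactor q n

/-- Euler's series at `q ^ (m + 1)`, with additional weights `c`. -/
noncomputable def eulerSeries (q : ℂ) (c : ℕ → ℂ) (m : ℕ) : ℂ :=
  ∑' n, eulerTerm q n * c n * q ^ (n * m)

/-- The weights `(-1) ^ n * q ^ (n choose 2)` of Euler's second series. -/
noncomputable def thetaWeight (q : ℂ) (n : ℕ) : ℂ := (-1) ^ n * q ^ n.choose 2

section

variable {q : ℂ}

lemma one_sub_pow_succ_ne_zero (hq : ‖q‖ < 1) (n : ℕ) : 1 - q ^ (n + 1) ≠ 0 := by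
  intro h
  have h1 : ‖q ^ (n + 1)‖ < 1 := by
    rw [norm_pow]
    exact pow_lt_one₀ (norm_nonneg _) hq n.succ_ne_zero
  rw [← sub_eq_zero.mp h] at h1
  simp at h1

lemma qFactor_zero : qFactor q 0 = 1 := by simp [qFactor]

lemma qFactor_succ (n : ℕ) : qFactor q (n + 1) = qFactor q n * (1 - q ^ (n + 1)) :=
  Finset.prod_range_succ _ _

lemma qFactor_ne_zero (hq : ‖q‖ < 1) (n : ℕ) : qFactor q n ≠ 0 :=
  Finset.prod_ne_zero_iff.mpr fun _ _ ↦ one_sub_pow_succ_ne_zero hq _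

lemma tendsto_qFactor (hq : ‖q‖ < 1) :
    Tendsto (qFactor q) atTop (𝓝 (∏' j : ℕ, (1 - q ^ (j + 1)))) := by
  have h : Multipliable fun j : ℕ ↦ 1 + -q ^ (j + 1) := by
    apply multipliable_one_add_of_summable
    simpa [pow_succ] using
      (summable_geometric_of_lt_one (norm_nonneg q) hq).mul_right ‖q‖
  simp only [← sub_eq_add_neg] at h
  exact h.hasProd.tendsto_prod_nat

lemma eulerTerm_zero : eulerTerm q 0 = 1 := by simp [eulerTerm, qFactor_zero]

lemma eulerTerm_succ (hq : ‖q‖ < 1) (n : ℕ) :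
    eulerTerm q (n + 1) * (1 - q ^ (n + 1)) = q * eulerTerm q n := by
  have h1 := one_sub_pow_succ_ne_zero hq n
  have h2 := qFactor_ne_zero hq n
  rw [eulerTerm, eulerTerm, qFactor_succ]
  field_simp
  exact pow_succ' q n

lemma summable_norm_eulerTerm (hq : ‖q‖ < 1) : Summable fun n ↦ ‖eulerTerm q n‖ := by
  obtain ⟨r, hr, hr1⟩ := exists_between hq
  have hlim : Tendsto (fun n : ℕ ↦ ‖q / (1 - q ^ (n + 1))‖) atTop (𝓝 ‖q‖) := by
    have h := (tendsto_pow_atTop_nhds_zero_of_norm_lt_one hq).comp (tendsto_add_atTop_nat 1)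
    have h' := ((tendsto_const_nhds (x := q)).div (h.const_sub 1) (by simp)).norm
    simpa using h'
  refine summable_of_ratio_norm_eventually_le hr1 ?_
  filter_upwards [hlim.eventually_lt_const hr] with n hn
  have h1 := one_sub_pow_succ_ne_zero hq n
  have : eulerTerm q (n + 1) = q / (1 - q ^ (n + 1)) * eulerTerm q n := by
    rw [div_mul_eq_mul_div, ← eulerTerm_succ hq, mul_div_cancel_right₀ _ h1]
  rw [norm_norm, norm_norm, this, norm_mul]
  gcongr

lemma norm_eulerTerm_mul_le (hq : ‖q‖ < 1) {c : ℕ → ℂ} (hc : ∀ n, ‖c n‖ ≤ 1) (m n : ℕ) :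
    ‖eulerTerm q n * c n * q ^ (n * m)‖ ≤ ‖eulerTerm q n‖ := by
  rw [norm_mul, norm_mul, norm_pow, mul_assoc]
  exact mul_le_of_le_one_right (norm_nonneg _)
    (mul_le_one₀ (hc n) (by positivity) (pow_le_one₀ (norm_nonneg _) hq.le))

lemma summable_eulerSeries (hq : ‖q‖ < 1) {c : ℕ → ℂ} (hc : ∀ n, ‖c n‖ ≤ 1) (m : ℕ) :
    Summable fun n ↦ eulerTerm q n * c n * q ^ (n * m) :=
  .of_norm_bounded (summable_norm_eulerTerm hq) (norm_eulerTerm_mul_le hq hc m)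

lemma tendsto_eulerSeries (hq : ‖q‖ < 1) {c : ℕ → ℂ} (hc : ∀ n, ‖c n‖ ≤ 1) :
    Tendsto (eulerSeries q c) atTop (𝓝 (c 0)) := by
  have h : Tendsto (eulerSeries q c) atTop (𝓝 (∑' n, if n = 0 then c 0 else 0)) := by
    refine tendsto_tsum_of_dominated_convergence (summable_norm_eulerTerm hq) (fun n ↦ ?_)
      (.of_forall fun m n ↦ norm_eulerTerm_mul_le hq hc m n)
    rcases eq_or_ne n 0 with rfl | hn
    · simp [eulerTerm_zero]
    · have hqn : ‖q ^ n‖ < 1 := by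
        rw [norm_pow]
        exact pow_lt_one₀ (norm_nonneg _) hq hn
      simpa [hn, pow_mul] using
        (tendsto_pow_atTop_nhds_zero_of_norm_lt_one hqn).const_mul (eulerTerm q n * c n)
  simpa using h

lemma eulerSeries_sub_succ (hq : ‖q‖ < 1) {c : ℕ → ℂ} (hc : ∀ n, ‖c n‖ ≤ 1) (m : ℕ) :
    eulerSeries q c m - eulerSeries q c (m + 1) =
      q ^ (m + 1) * ∑' n, eulerTerm q n * c (n + 1) * q ^ (n * m) := by
  have h1 := summable_eulerSeries hq hc m
  have h2 := summable_eulerSeries hq hc (m + 1)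
  rw [eulerSeries, eulerSeries, ← h1.tsum_sub h2, (h1.sub h2).tsum_eq_zero_add, ← tsum_mul_left]
  simp only [zero_mul, sub_self, zero_add]
  refine tsum_congr fun n ↦ ?_
  linear_combination (c (n + 1) * q ^ ((n + 1) * m)) * eulerTerm_succ hq n

lemma eulerSeries_one_eq (hq : ‖q‖ < 1) (m : ℕ) :
    eulerSeries q 1 m = qFactor q m * eulerSeries q 1 0 := by
  induction m with
  | zero => simp [qFactor_zero]
  | succ m ih =>
    have h := eulerSeries_sub_succ hq (c := 1) (by simp) m
    change _ = _ * eulerSeries q 1 m at h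
    rw [qFactor_succ]
    linear_combination (1 - q ^ (m + 1)) * ih - h

lemma norm_thetaWeight_le (hq : ‖q‖ < 1) (n : ℕ) : ‖thetaWeight q n‖ ≤ 1 := by
  simpa [thetaWeight] using pow_le_one₀ (norm_nonneg q) hq.le

lemma thetaWeight_succ (n : ℕ) : thetaWeight q (n + 1) = -(q ^ n * thetaWeight q n) := by
  have : (n + 1).choose 2 = n + n.choose 2 := by simp [Nat.choose_succ_succ' n 1]
  rw [thetaWeight, thetaWeight, this]
  ring

lemma eulerSeries_theta_eq (hq : ‖q‖ < 1) (m : ℕ) :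
    eulerSeries q (thetaWeight q) 0 = qFactor q m * eulerSeries q (thetaWeight q) m := by
  induction m with
  | zero => simp [qFactor_zero]
  | succ m ih =>
    have h := eulerSeries_sub_succ hq (norm_thetaWeight_le hq) m
    have h' : ∑' n, eulerTerm q n * thetaWeight q (n + 1) * q ^ (n * m) =
        -eulerSeries q (thetaWeight q) (m + 1) := by
      rw [eulerSeries, ← tsum_neg]
      refine tsum_congr fun n ↦ ?_
      rw [thetaWeight_succ]
      ring
    rw [h'] at h
    rw [qFactor_succ]
    linear_combination ih + qFactor q m * h

lemma tprod_mul_eulerSeries_one (hq : ‖q‖ < 1) :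
    (∏' j : ℕ, (1 - q ^ (j + 1))) * eulerSeries q 1 0 = 1 := by
  refine tendsto_nhds_unique ((tendsto_qFactor hq).mul_const _) ?_
  simp only [← eulerSeries_one_eq hq]
  exact tendsto_eulerSeries hq (c := 1) (by simp)

lemma eulerSeries_theta_zero (hq : ‖q‖ < 1) :
    eulerSeries q (thetaWeight q) 0 = ∏' j : ℕ, (1 - q ^ (j + 1)) := by
  have h := (tendsto_qFactor hq).mul (tendsto_eulerSeries hq (norm_thetaWeight_le hq))
  simp only [← eulerSeries_theta_eq hq] at h
  simpa [thetaWeight] using tendsto_nhds_unique tendsto_const_nhds h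

lemma tsum_eulerTerm_mul_eulerSeries_comm (hq : ‖q‖ < 1) {c : ℕ → ℂ} (hc : ∀ n, ‖c n‖ ≤ 1) :
    ∑' k, eulerTerm q k * eulerSeries q c k =
      ∑' n, eulerTerm q n * c n * eulerSeries q 1 n := by
  have hs : Summable (Function.uncurry fun k n ↦
      eulerTerm q k * (eulerTerm q n * c n * q ^ (n * k))) := by
    refine .of_norm_bounded ((summable_norm_eulerTerm hq).mul_of_nonneg
      (summable_norm_eulerTerm hq) (fun _ ↦ norm_nonneg _) (fun _ ↦ norm_nonneg _)) ?_
    rintro ⟨k, n⟩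
    simp only [Function.uncurry_apply_pair]
    rw [norm_mul]
    gcongr
    exact norm_eulerTerm_mul_le hq hc k n
  simp only [eulerSeries, ← tsum_mul_left]
  rw [← hs.tsum_comm]
  refine tsum_congr fun n ↦ tsum_congr fun k ↦ ?_
  rw [Pi.one_apply, mul_comm n k]
  ring

end

/-- **Ramanujan's identity** (lost notebook, page 200):
`∑_{k=0}^∞ (−1)^k q^{k(k+1)/2}
  = (∏_{j=1}^∞ (1−q^j))^2 · ∑_{k=0}^∞ q^k / (∏_{j=1}^k (1−q^j))^2`
for every complex `q` with `|q| < 1`. -/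
theorem ramanujan_page200 (q : ℂ) (hq : ‖q‖ < 1) :
    ∑' k : ℕ, (-1 : ℂ) ^ k * q ^ (k * (k + 1) / 2) =
      (∏' j : ℕ, (1 - q ^ (j + 1))) ^ 2 *
        ∑' k : ℕ, q ^ k / (∏ j ∈ Finset.range k, (1 - q ^ (j + 1))) ^ 2 := by
  have hR : (∏' j : ℕ, (1 - q ^ (j + 1))) *
      ∑' k : ℕ, q ^ k / (∏ j ∈ Finset.range k, (1 - q ^ (j + 1))) ^ 2 =
      ∑' k, eulerTerm q k * eulerSeries q (thetaWeight q) k := by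
    rw [← tsum_mul_left]
    refine tsum_congr fun k ↦ ?_
    have h := qFactor_ne_zero hq k
    rw [← eulerSeries_theta_zero hq, eulerSeries_theta_eq hq k, eulerTerm, ← qFactor]
    field_simp
  rw [pow_two, mul_assoc, hR, tsum_eulerTerm_mul_eulerSeries_comm hq (norm_thetaWeight_le hq),
    ← tsum_mul_left]
  refine tsum_congr fun n ↦ ?_
  have h := qFactor_ne_zero hq n
  have hexp : n * (n + 1) / 2 = n + n.choose 2 := by
    have h2 := Nat.choose_two_right (n + 1)
    rw [Nat.choose_succ_succ' n 1, Nat.choose_one_right, Nat.add_sub_cancel] at h2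
    rw [mul_comm, ← h2]
  have ha : eulerTerm q n * qFactor q n = q ^ n := div_mul_cancel₀ _ h
  rw [eulerSeries_one_eq hq, hexp, thetaWeight, pow_add]
  linear_combination (-(-1) ^ n * q ^ n.choose 2) * ha -
    (eulerTerm q n * qFactor q n * (-1) ^ n * q ^ n.choose 2) * tprod_mul_eulerSeries_one hq
end

section
/- (Andrews–Gordon identities.) For every integer k ≥ 2 and every complex number q with |q| < 1: ∑_{m∈ℤ} (−1)^m q^{k·m(m+1) + m(m−1)/2} = (q;q)_∞ · ∑_{n_1,…,n_{k−1} ≥ 0} q^{N_1^2 + ⋯ + N_{k−1}^2 + N_1 + ⋯ + N_{k−1}} / ((q;q)_{n_1} ⋯ (q;q)_{n_{k−1}}), where N_j = n_j + n_{j+1} + ⋯ + n_{k−1} for 1 ≤ j ≤ k−1. -/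
open Finset Filter Topology

/-- The finite `q`-Pochhammer symbol `(q;q)_n`. -/
def qPoch {K : Type*} [CommRing K] (q : K) (n : ℕ) : K :=
  ∏ i ∈ range n, (1 - q ^ (i + 1))

/-- The unit Bailey pair sequence relative to `q`, up to the factor `1 - q`. -/
def unitBailey {K : Type*} [CommRing K] (q : K) (r : ℕ) : K :=
  (-1) ^ r * q ^ r.choose 2 * (1 - q ^ (2 * r + 1))

/-- The summand of the Andrews–Gordon multisum with `d` summation variables. -/
def gordonSummand {K : Type*} [Field K] (q : K) {d : ℕ} (n : Fin d → ℕ) : K :=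
  q ^ (∑ j, ((∑ i ∈ Ici j, n i) ^ 2 + ∑ i ∈ Ici j, n i)) / ∏ j, qPoch q (n j)

/-- The part of the Andrews–Gordon multisum with `n_1 + ⋯ + n_d = s`. -/
def gordonLevel {K : Type*} [Field K] (q : K) (d s : ℕ) : K :=
  ∑ n ∈ Finset.Nat.antidiagonalTuple d s, gordonSummand q n

section Algebra

variable {K : Type*} [Field K] {q : K}

theorem qPoch_zero (q : K) : qPoch q 0 = 1 := by simp [qPoch]

theorem qPoch_succ (q : K) (n : ℕ) : qPoch q (n + 1) = qPoch q n * (1 - q ^ (n + 1)) := by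
  simp [qPoch, prod_range_succ]

theorem one_sub_pow_ne_zero_of_qPoch (hP : ∀ n, qPoch q n ≠ 0) (n : ℕ) :
    1 - q ^ (n + 1) ≠ 0 :=
  right_ne_zero_of_mul (qPoch_succ q n ▸ hP (n + 1))

/-- A form of the `q`-Chu–Vandermonde summation. -/
theorem sum_antidiagonal_qVandermonde (hP : ∀ n, qPoch q n ≠ 0) (n c : ℕ) :
    ∑ p ∈ antidiagonal n, q ^ (p.2 * (p.2 + c)) / (qPoch q p.1 * qPoch q p.2 * qPoch q (p.2 + c)) =
      1 / (qPoch q n * qPoch q (n + c)) := by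
  have h1 := one_sub_pow_ne_zero_of_qPoch hP
  induction n generalizing c with
  | zero => simp [qPoch_zero]
  | succ n ih =>
    set t : ℕ × ℕ → K := fun p =>
      q ^ (p.2 * (p.2 + c)) / (qPoch q p.1 * qPoch q p.2 * qPoch q (p.2 + c)) with ht
    have hsplit : (1 - q ^ (n + 1)) * ∑ p ∈ antidiagonal (n + 1), t p =
        ∑ p ∈ antidiagonal (n + 1), (1 - q ^ p.1) * t p +
          ∑ p ∈ antidiagonal (n + 1), q ^ p.1 * (1 - q ^ p.2) * t p := by
      rw [mul_sum, ← sum_add_distrib]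
      refine sum_congr rfl fun p hp => ?_
      rw [← mem_antidiagonal.1 hp, pow_add]
      ring
    have hfst : ∑ p ∈ antidiagonal (n + 1), (1 - q ^ p.1) * t p =
        1 / (qPoch q n * qPoch q (n + c)) := by
      rw [Finset.Nat.sum_antidiagonal_succ, ← ih]
      simp only [pow_zero, sub_self, zero_mul, zero_add]
      refine sum_congr rfl fun p _ => ?_
      have := h1 p.1
      have := hP p.1
      have := hP p.2
      have := hP (p.2 + c)
      simp only [ht, qPoch_succ]
      field_simp
    have hsnd : ∑ p ∈ antidiagonal (n + 1), q ^ p.1 * (1 - q ^ p.2) * t p =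
        q ^ (n + c + 1) / (qPoch q n * qPoch q (n + (c + 1))) := by
      rw [Finset.Nat.sum_antidiagonal_succ', ← mul_one_div, ← ih, mul_sum]
      simp only [pow_zero, sub_self, zero_mul, mul_zero, zero_add]
      refine sum_congr rfl fun p hp => ?_
      have := h1 p.2
      have := hP p.1
      have := hP p.2
      have := hP (p.2 + (c + 1))
      have e : p.2 + 1 + c = p.2 + (c + 1) := by ring
      simp only [ht, qPoch_succ, e]
      rw [← mem_antidiagonal.1 hp]
      field_simp
      ring
    rw [hfst, hsnd] at hsplit
    refine mul_left_cancel₀ (h1 n) (hsplit.trans ?_)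
    have e1 : n + (c + 1) = n + c + 1 := by ring
    have e2 : n + 1 + c = n + c + 1 := by ring
    have := h1 n
    have := h1 (n + c)
    have := hP n
    have := hP (n + c)
    simp only [e1, e2, qPoch_succ]
    field_simp
    ring

/-- Bailey's lemma relative to `q`, in the limiting case of both parameters tending to infinity. -/
theorem bailey_lemma (hP : ∀ n, qPoch q n ≠ 0) {α β : ℕ → K}
    (h : ∀ L, β L = ∑ p ∈ antidiagonal L, α p.2 / (qPoch q p.1 * qPoch q (p.1 + (2 * p.2 + 1))))
    (L : ℕ) :
    ∑ p ∈ antidiagonal L, q ^ (p.2 ^ 2 + p.2) * β p.2 / qPoch q p.1 =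
      ∑ p ∈ antidiagonal L,
        q ^ (p.2 ^ 2 + p.2) * α p.2 / (qPoch q p.1 * qPoch q (p.1 + (2 * p.2 + 1))) := by
  calc
    _ = ∑ p ∈ antidiagonal L, ∑ u ∈ antidiagonal p.2, q ^ ((u.1 + u.2) ^ 2 + (u.1 + u.2)) *
          (α u.2 / (qPoch q u.1 * qPoch q (u.1 + (2 * u.2 + 1)))) / qPoch q p.1 := by
      refine sum_congr rfl fun p _ => ?_
      rw [h, mul_sum, sum_div]
      refine sum_congr rfl fun u hu => ?_
      rw [mem_antidiagonal.1 hu]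
    _ = ∑ p ∈ antidiagonal L, ∑ u ∈ antidiagonal p.1, q ^ ((u.2 + p.2) ^ 2 + (u.2 + p.2)) *
          (α p.2 / (qPoch q u.2 * qPoch q (u.2 + (2 * p.2 + 1)))) / qPoch q u.1 := by
      rw [sum_sigma', sum_sigma']
      refine sum_bij' (fun x _ => ⟨(x.1.1 + x.2.1, x.2.2), (x.1.1, x.2.1)⟩)
        (fun x _ => ⟨(x.2.1, x.2.2 + x.1.2), (x.2.2, x.1.2)⟩) ?_ ?_ ?_ ?_ ?_ <;>
      · rintro ⟨⟨a, b⟩, c, e⟩ h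
        simp only [mem_sigma, HasAntidiagonal.mem_antidiagonal] at h
        obtain ⟨rfl, rfl⟩ := h
        simp [add_assoc]
    _ = _ := by
      refine sum_congr rfl fun p _ => ?_
      rw [← mul_one_div, ← sum_antidiagonal_qVandermonde hP, mul_sum]
      refine sum_congr rfl fun u _ => ?_
      have := hP u.1
      have := hP u.2
      have := hP (u.2 + (2 * p.2 + 1))
      field_simp
      ring

theorem sum_range_unitBailey (hP : ∀ n, qPoch q n ≠ 0) (m R : ℕ) :
    (1 - q ^ (m + R)) * ∑ r ∈ range R,
        unitBailey q r / (qPoch q (m + R - r) * qPoch q (m + R + r + 1)) =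
      -((1 - q ^ R) * (-1) ^ R * q ^ R.choose 2 / (qPoch q m * qPoch q (m + 2 * R))) := by
  have h1 := one_sub_pow_ne_zero_of_qPoch hP
  induction R generalizing m with
  | zero => simp
  | succ R ih =>
    have e1 : m + (R + 1) = m + 1 + R := by ring
    have e2 : m + 1 + R - R = m + 1 := by omega
    have e3 : m + 1 + R + R + 1 = m + 2 * R + 2 := by ring
    have e4 : m + 1 + 2 * R = m + 2 * R + 1 := by ring
    have e5 : m + 2 * (R + 1) = m + 2 * R + 2 := by ring
    rw [e1, sum_range_succ, mul_add, ih, e2, e3, e4, e5, unitBailey]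
    have := h1 m
    have := h1 (m + 2 * R)
    have := h1 (m + 2 * R + 1)
    have := hP m
    have := hP (m + 2 * R)
    have e6 : (R + 1).choose 2 = R + R.choose 2 := by
      simp [Nat.choose_succ_succ' R 1]
    simp only [qPoch_succ, e6]
    field_simp
    ring

theorem sum_antidiagonal_unitBailey (hP : ∀ n, qPoch q n ≠ 0) (L : ℕ) :
    ∑ p ∈ antidiagonal L, unitBailey q p.2 / (qPoch q p.1 * qPoch q (p.1 + (2 * p.2 + 1))) =
      if L = 0 then 1 else 0 := by
  have h1 := one_sub_pow_ne_zero_of_qPoch hP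
  rcases L with _ | L
  · have := h1 0
    simp_all [unitBailey, qPoch]
  have h := sum_range_unitBailey hP 0 (L + 1)
  rw [← Finset.Nat.sum_antidiagonal_swap, Finset.Nat.sum_antidiagonal_eq_sum_range_succ_mk,
    sum_range_succ, if_neg (Nat.succ_ne_zero L)]
  simp only [Prod.fst_swap, Prod.snd_swap, Nat.sub_self]
  refine (mul_eq_zero.1 ?_).resolve_left (h1 L)
  have hs : ∑ r ∈ range (L + 1),
      unitBailey q r / (qPoch q (L + 1 - r) * qPoch q (L + 1 - r + (2 * r + 1))) =
      ∑ r ∈ range (L + 1),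
        unitBailey q r / (qPoch q (0 + (L + 1) - r) * qPoch q (0 + (L + 1) + r + 1)) := by
    refine sum_congr rfl fun r hr => ?_
    have := mem_range.1 hr
    rw [show L + 1 - r + (2 * r + 1) = 0 + (L + 1) + r + 1 by omega, zero_add]
  rw [zero_add (L + 1)] at h hs
  rw [mul_add, hs, h, unitBailey, zero_add, zero_add, qPoch_succ q (2 * (L + 1))]
  have := h1 (2 * (L + 1))
  have := hP 0
  have := hP (2 * (L + 1))
  field_simp
  ring

theorem gordonSummand_cons (q : K) {d : ℕ} (a : ℕ) (n : Fin d → ℕ) :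
    gordonSummand q (Fin.cons a n : Fin (d + 1) → ℕ) =
      q ^ ((a + ∑ i, n i) ^ 2 + (a + ∑ i, n i)) * gordonSummand q n / qPoch q a := by
  have h0 : ∑ i ∈ Ici (0 : Fin (d + 1)), (Fin.cons a n : Fin (d + 1) → ℕ) i = a + ∑ i, n i := by
    rw [show Ici (0 : Fin (d + 1)) = univ by ext; simp, Fin.sum_univ_succ]
    simp
  have hs (j : Fin d) :
      ∑ i ∈ Ici j.succ, (Fin.cons a n : Fin (d + 1) → ℕ) i = ∑ i ∈ Ici j, n i := by
    rw [← Fin.map_succEmb_Ici, sum_map]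
    simp
  simp only [gordonSummand, Fin.sum_univ_succ, Fin.prod_univ_succ, h0, hs, Fin.cons_zero,
    Fin.cons_succ]
  rw [pow_add, div_mul_eq_div_div_swap, mul_div_assoc]

theorem gordonLevel_zero (q : K) (s : ℕ) : gordonLevel q 0 s = if s = 0 then 1 else 0 := by
  rcases s with _ | s <;> simp [gordonLevel, gordonSummand]

theorem gordonLevel_succ (q : K) (d s : ℕ) :
    gordonLevel q (d + 1) s =
      q ^ (s ^ 2 + s) * ∑ p ∈ antidiagonal s, gordonLevel q d p.2 / qPoch q p.1 := by
  simp only [gordonLevel, sum_div, mul_sum]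
  rw [sum_sigma']
  refine sum_bij' (fun n _ => ⟨(n 0, ∑ i, Fin.tail n i), Fin.tail n⟩)
    (fun x _ => Fin.cons x.1.1 x.2)
    ?_ ?_ ?_ ?_ ?_
  · intro n hn
    simpa [Finset.Nat.mem_antidiagonalTuple, Fin.sum_univ_succ, Fin.tail] using hn
  · rintro ⟨⟨a, t⟩, n⟩ hx
    simp only [mem_sigma, HasAntidiagonal.mem_antidiagonal, Finset.Nat.mem_antidiagonalTuple] at hx
    simp [Finset.Nat.mem_antidiagonalTuple, Fin.sum_univ_succ, hx.2, hx.1]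
  · intro n _
    simp
  · rintro ⟨⟨a, t⟩, n⟩ hx
    simp only [mem_sigma, HasAntidiagonal.mem_antidiagonal, Finset.Nat.mem_antidiagonalTuple] at hx
    simp [hx.2]
  · intro n hn
    have h : n 0 + ∑ i, Fin.tail n i = s := by
      simpa [Finset.Nat.mem_antidiagonalTuple, Fin.sum_univ_succ, Fin.tail] using hn
    conv_lhs => rw [← Fin.cons_self_tail n, gordonSummand_cons, h]
    ring

/-- The finite form of the Andrews–Gordon identities obtained by iterating Bailey's lemma. -/
theorem sum_antidiagonal_gordonLevel (hP : ∀ n, qPoch q n ≠ 0) (d L : ℕ) :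
    ∑ p ∈ antidiagonal L, gordonLevel q d p.2 / qPoch q p.1 =
      ∑ p ∈ antidiagonal L, (q ^ ((d + 1) * (p.2 ^ 2 + p.2)) * unitBailey q p.2) /
        (qPoch q p.1 * qPoch q (p.1 + (2 * p.2 + 1))) := by
  induction d generalizing L with
  | zero =>
    have h := bailey_lemma hP (fun L => (sum_antidiagonal_unitBailey hP L).symm) L
    simp only [zero_add, one_mul]
    rw [← h]
    refine sum_congr rfl fun p _ => ?_
    rw [gordonLevel_zero]
    split_ifs with hp <;> simp [hp]
  | succ d ih =>
    simp only [gordonLevel_succ]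
    rw [bailey_lemma hP (α := fun r => q ^ ((d + 1) * (r ^ 2 + r)) * unitBailey q r)
      (β := fun L => ∑ p ∈ antidiagonal L, gordonLevel q d p.2 / qPoch q p.1) ih]
    refine sum_congr rfl fun p _ => ?_
    ring

end Algebra

section Analysis

variable {q : ℂ}

theorem qPoch_ne_zero (hq : ‖q‖ < 1) (n : ℕ) : qPoch q n ≠ 0 := by
  refine prod_ne_zero_iff.2 fun i _ h => ?_
  have h1 : ‖q ^ (i + 1)‖ < 1 := by
    rw [norm_pow]
    exact pow_lt_one₀ (norm_nonneg q) hq i.succ_ne_zero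
  rw [← sub_eq_zero.1 h, norm_one] at h1
  exact lt_irrefl _ h1

theorem tendsto_qPoch (hq : ‖q‖ < 1) :
    Tendsto (qPoch q) atTop (𝓝 (∏' j : ℕ, (1 - q ^ (j + 1)))) :=
  (ModularForm.multipliable_one_sub_pow hq).tendsto_prod_tprod_nat

theorem tprod_one_sub_pow_ne_zero (hq : ‖q‖ < 1) : ∏' j : ℕ, (1 - q ^ (j + 1)) ≠ 0 := by
  simp only [sub_eq_add_neg]
  refine tprod_one_add_ne_zero_of_summable (f := fun j => -q ^ (j + 1)) (fun i h => ?_) ?_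
  · rw [← sub_eq_add_neg] at h
    exact one_sub_pow_ne_zero_of_qPoch (qPoch_ne_zero hq) i h
  · simp only [norm_neg, norm_pow]
    exact (summable_nat_add_iff 1).2 (summable_geometric_of_lt_one (norm_nonneg q) hq)

theorem exists_norm_inv_qPoch_le (hq : ‖q‖ < 1) : ∃ C, ∀ n, ‖(qPoch q n)⁻¹‖ ≤ C := by
  obtain ⟨C, hC⟩ := (Metric.isBounded_range_of_tendsto _
    ((tendsto_qPoch hq).inv₀ (tprod_one_sub_pow_ne_zero hq))).exists_norm_le
  exact ⟨C, fun n => hC _ ⟨n, rfl⟩⟩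

/-- Tannery's theorem for sums over antidiagonals. -/
theorem tendsto_sum_antidiagonal_mul {c : ℕ → ℂ} {w : ℕ → ℕ → ℂ} {C : ℝ} {l : ℂ}
    (hc : Summable fun r => ‖c r‖) (hw : ∀ m r, ‖w m r‖ ≤ C)
    (hl : ∀ r, Tendsto (fun m => w m r) atTop (𝓝 l)) :
    Tendsto (fun L => ∑ p ∈ antidiagonal L, c p.2 * w p.1 p.2) atTop (𝓝 ((∑' r, c r) * l)) := by
  have hC : 0 ≤ C := (norm_nonneg _).trans (hw 0 0)
  have h := tendsto_tsum_of_dominated_convergence (𝓕 := atTop)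
    (f := fun L r => if r ≤ L then c r * w (L - r) r else 0) (g := fun r => c r * l)
    (bound := fun r => ‖c r‖ * C) (hc.mul_right C) (fun r => ?_)
    (Eventually.of_forall fun L r => ?_)
  · rw [← tsum_mul_right]
    refine h.congr fun L => ?_
    rw [← Finset.Nat.sum_antidiagonal_swap, Finset.Nat.sum_antidiagonal_eq_sum_range_succ_mk,
      tsum_eq_sum (s := range (L + 1))]
    · refine sum_congr rfl fun r hr => ?_
      rw [if_pos (Nat.lt_succ_iff.1 (mem_range.1 hr))]
      rfl
    · intro r hr
      rw [if_neg fun h => hr (mem_range.2 (Nat.lt_succ_iff.2 h))]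
  · refine (((hl r).comp (tendsto_sub_atTop_nat r)).const_mul (c r)).congr' ?_
    filter_upwards [eventually_ge_atTop r] with L hL
    simp [hL]
  · split_ifs
    · rw [norm_mul]
      exact mul_le_mul_of_nonneg_left (hw _ _) (norm_nonneg _)
    · simpa using mul_nonneg (norm_nonneg (c r)) hC

theorem summable_prod_pow {x : ℝ} (h0 : 0 ≤ x) (h1 : x < 1) (d : ℕ) :
    Summable fun n : Fin d → ℕ => ∏ j, x ^ n j := by
  induction d with
  | zero => exact Summable.of_finite
  | succ d ih =>
    rw [← (Fin.consEquiv fun _ : Fin (d + 1) => ℕ).summable_iff]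
    refine ((summable_geometric_of_lt_one h0 h1).mul_of_nonneg ih (fun n => pow_nonneg h0 n)
      fun n => prod_nonneg fun j _ => pow_nonneg h0 _).congr fun p => ?_
    simp [Fin.prod_univ_succ, Fin.consEquiv]

theorem summable_norm_gordonSummand (hq : ‖q‖ < 1) (d : ℕ) :
    Summable fun n : Fin d → ℕ => ‖gordonSummand q n‖ := by
  obtain ⟨C, hC⟩ := exists_norm_inv_qPoch_le hq
  refine Summable.of_nonneg_of_le (fun _ => norm_nonneg _) (fun n => ?_)
    ((summable_prod_pow (norm_nonneg q) hq d).mul_right (C ^ d))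
  rw [gordonSummand, div_eq_mul_inv, norm_mul, norm_pow, ← prod_inv_distrib, norm_prod,
    prod_pow_eq_pow_sum]
  refine mul_le_mul ?_ ?_ (prod_nonneg fun _ _ => norm_nonneg _)
    (pow_nonneg (norm_nonneg q) _)
  · refine pow_le_pow_of_le_one (norm_nonneg q) hq.le (sum_le_sum fun j _ => ?_)
    exact (single_le_sum (fun i _ => Nat.zero_le (n i)) (mem_Ici.2 le_rfl)).trans
      (Nat.le_add_left _ _)
  · refine (prod_le_prod (fun _ _ => norm_nonneg _) fun j _ => hC (n j)).trans ?_
    simp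

theorem hasSum_gordonLevel (hq : ‖q‖ < 1) (d : ℕ) :
    HasSum (gordonLevel q d) (∑' n : Fin d → ℕ, gordonSummand q n) := by
  have h := (Finset.Nat.sigmaAntidiagonalTupleEquivTuple d).hasSum_iff.2
    (summable_norm_gordonSummand hq d).of_norm.hasSum
  refine h.sigma fun s => ?_
  exact Finset.hasSum (Finset.Nat.antidiagonalTuple d s) (gordonSummand q)

theorem summable_norm_gordonLevel (hq : ‖q‖ < 1) (d : ℕ) :
    Summable fun s => ‖gordonLevel q d s‖ :=
  (hasSum_gordonLevel hq d).summable.norm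

theorem summable_norm_pow_mul_unitBailey (hq : ‖q‖ < 1) (d : ℕ) :
    Summable fun r => ‖q ^ ((d + 1) * (r ^ 2 + r)) * unitBailey q r‖ := by
  refine Summable.of_nonneg_of_le (fun _ => norm_nonneg _) (fun r => ?_)
    ((summable_geometric_of_lt_one (norm_nonneg q) hq).mul_right 2)
  have h1 : ‖unitBailey q r‖ ≤ 2 := by
    have h2 : ‖1 - q ^ (2 * r + 1)‖ ≤ 2 := by
      refine (norm_sub_le _ _).trans ?_
      have := pow_le_one₀ (n := 2 * r + 1) (norm_nonneg q) hq.le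
      rw [norm_one, norm_pow]
      linarith
    have h3 := pow_le_one₀ (n := r.choose 2) (norm_nonneg q) hq.le
    simp only [unitBailey, norm_mul, norm_pow, norm_neg, norm_one, one_pow, one_mul]
    nlinarith [norm_nonneg (1 - q ^ (2 * r + 1))]
  rw [norm_mul, norm_pow]
  refine mul_le_mul (pow_le_pow_of_le_one (norm_nonneg q) hq.le ?_) h1 (norm_nonneg _)
    (pow_nonneg (norm_nonneg q) _)
  nlinarith [Nat.zero_le (d * (r ^ 2 + r)), Nat.zero_le (r ^ 2)]

theorem tsum_unitBailey_eq (hq : ‖q‖ < 1) (d : ℕ) :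
    ∑' r, q ^ ((d + 1) * (r ^ 2 + r)) * unitBailey q r =
      (∏' j : ℕ, (1 - q ^ (j + 1))) * ∑' n : Fin d → ℕ, gordonSummand q n := by
  obtain ⟨C, hC⟩ := exists_norm_inv_qPoch_le hq
  have hC0 : 0 ≤ C := (norm_nonneg _).trans (hC 0)
  have hne := tprod_one_sub_pow_ne_zero hq
  have hinv := (tendsto_qPoch hq).inv₀ hne
  have hleft := tendsto_sum_antidiagonal_mul (w := fun m _ => (qPoch q m)⁻¹)
    (summable_norm_gordonLevel hq d) (fun m _ => hC m) (fun _ => hinv)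
  have hright := tendsto_sum_antidiagonal_mul
    (w := fun m r => (qPoch q m)⁻¹ * (qPoch q (m + (2 * r + 1)))⁻¹) (C := C * C)
    (summable_norm_pow_mul_unitBailey hq d)
    (fun m r => by
      rw [norm_mul]
      exact mul_le_mul (hC _) (hC _) (norm_nonneg _) hC0)
    (fun r => hinv.mul (hinv.comp (tendsto_add_atTop_nat (2 * r + 1))))
  have h := tendsto_nhds_unique (hleft.congr fun L => ?_) hright
  · rw [(hasSum_gordonLevel hq d).tsum_eq] at h
    field_simp at h
    rw [← h]
    ring
  · have := sum_antidiagonal_gordonLevel (qPoch_ne_zero hq) d L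
    simpa only [div_eq_mul_inv, mul_inv] using this

theorem zpow_theta_exponent_natCast (q : ℂ) (k r : ℕ) :
    q ^ ((k : ℤ) * ((r : ℤ) * (r + 1)) + (r : ℤ) * (r - 1) / 2) =
      q ^ (k * (r ^ 2 + r)) * q ^ r.choose 2 := by
  have h : (r : ℤ) * (r - 1) / 2 = (r.choose 2 : ℕ) := by
    rcases r with _ | r
    · simp
    · rw [Nat.choose_two_right]
      push_cast
      simp
  rw [h, ← pow_add, ← zpow_natCast]
  congr 1
  push_cast
  ring

theorem zpow_theta_exponent_neg (q : ℂ) (k r : ℕ) :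
    q ^ ((k : ℤ) * (-((r : ℤ) + 1) * (-((r : ℤ) + 1) + 1)) +
        -((r : ℤ) + 1) * (-((r : ℤ) + 1) - 1) / 2) =
      q ^ (k * (r ^ 2 + r)) * q ^ (r.choose 2 + (2 * r + 1)) := by
  have h : -((r : ℤ) + 1) * (-((r : ℤ) + 1) - 1) / 2 = ((r + 2).choose 2 : ℕ) := by
    rw [Nat.choose_two_right]
    push_cast
    congr 1
    ring
  have h2 : (r + 2).choose 2 = r.choose 2 + (2 * r + 1) := by
    simp only [Nat.choose_succ_succ' (r + 1) 1, Nat.choose_succ_succ' r 1, Nat.choose_one_right]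
    ring
  rw [h, h2, ← pow_add, ← zpow_natCast]
  congr 1
  push_cast
  ring

theorem summable_pow_mul_theta (hq : ‖q‖ < 1) {k : ℕ} (hk : 1 ≤ k) (e : ℕ → ℕ) :
    Summable fun r : ℕ => (-1 : ℂ) ^ r * (q ^ (k * (r ^ 2 + r)) * q ^ e r) := by
  refine Summable.of_norm_bounded (summable_geometric_of_lt_one (norm_nonneg q) hq) fun r => ?_
  rw [← pow_add]
  simp only [norm_mul, norm_pow, norm_neg, norm_one, one_pow, one_mul]
  refine pow_le_pow_of_le_one (norm_nonneg q) hq.le ?_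
  nlinarith [Nat.zero_le (r ^ 2)]

theorem tsum_int_theta_eq (hq : ‖q‖ < 1) {k : ℕ} (hk : 1 ≤ k) :
    ∑' m : ℤ, (-1 : ℂ) ^ m * q ^ ((k : ℤ) * (m * (m + 1)) + m * (m - 1) / 2) =
      ∑' r : ℕ, q ^ (k * (r ^ 2 + r)) * unitBailey q r := by
  have hpos : (fun r : ℕ => (-1 : ℂ) ^ (r : ℤ) *
      q ^ ((k : ℤ) * ((r : ℤ) * (r + 1)) + (r : ℤ) * (r - 1) / 2)) =
      fun r => (-1) ^ r * (q ^ (k * (r ^ 2 + r)) * q ^ r.choose 2) := by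
    funext r
    rw [zpow_theta_exponent_natCast, zpow_natCast]
  have hneg : (fun r : ℕ => (-1 : ℂ) ^ (-((r : ℤ) + 1)) *
      q ^ ((k : ℤ) * (-((r : ℤ) + 1) * (-((r : ℤ) + 1) + 1)) +
        -((r : ℤ) + 1) * (-((r : ℤ) + 1) - 1) / 2)) =
      fun r => -((-1) ^ r * (q ^ (k * (r ^ 2 + r)) * q ^ (r.choose 2 + (2 * r + 1)))) := by
    funext r
    have hsign : (-1 : ℂ) ^ (-((r : ℤ) + 1)) = -(-1) ^ r := by
      rw [zpow_neg, ← inv_zpow, inv_neg_one]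
      exact_mod_cast pow_succ' (-1 : ℂ) r |>.trans (neg_one_mul _)
    rw [zpow_theta_exponent_neg, hsign, neg_mul]
  have hs1 := summable_pow_mul_theta hq hk fun r => r.choose 2
  have hs2 := (summable_pow_mul_theta hq hk fun r => r.choose 2 + (2 * r + 1)).neg
  rw [tsum_of_nat_of_neg_add_one (by rw [hpos]; exact hs1) (by rw [hneg]; exact hs2), hpos, hneg,
    ← hs1.tsum_add hs2]
  refine tsum_congr fun r => ?_
  rw [unitBailey, pow_add q (r.choose 2)]
  ring

end Analysis

/-- **The Andrews–Gordon identities.** For every integer `k ≥ 2` and complex `q`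
with `|q| < 1`:
`∑_{m∈ℤ} (−1)^m q^{k·m(m+1) + m(m−1)/2}
  = (q;q)_∞ · ∑_{n_1,…,n_{k−1} ≥ 0} q^{N_1²+⋯+N_{k−1}² + N_1+⋯+N_{k−1}} /
      ((q;q)_{n_1} ⋯ (q;q)_{n_{k−1}})`
where `N_j = n_j + ⋯ + n_{k−1}`. -/
theorem andrews_gordon (k : ℕ) (hk : 2 ≤ k) (q : ℂ) (hq : ‖q‖ < 1) :
    ∑' m : ℤ, (-1 : ℂ) ^ m * q ^ ((k : ℤ) * (m * (m + 1)) + m * (m - 1) / 2) =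
      (∏' j : ℕ, (1 - q ^ (j + 1))) *
        ∑' n : Fin (k - 1) → ℕ,
          q ^ (∑ j : Fin (k - 1),
                ((∑ i ∈ Finset.Ici j, n i) ^ 2 + ∑ i ∈ Finset.Ici j, n i)) /
            ∏ j : Fin (k - 1), ∏ i ∈ Finset.range (n j), (1 - q ^ (i + 1)) := by
  obtain ⟨d, rfl⟩ : ∃ d, k = d + 1 := ⟨k - 1, by omega⟩
  rw [tsum_int_theta_eq hq (by omega)]
  exact tsum_unitBailey_eq hq d
end

section
/- For every complex number q with |q| < 1 (equivalently, as an identity of formal power series in q): ∑_{r=0}^∞ q^{2r^2+r} − ∑_{r=1}^∞ q^{2r^2−r} = ((q;q)_∞)^2 · ∑_{k=0}^∞ q^k / ((q;q)_k)^2. -/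
open Filter Topology

/-- The finite `q`-Pochhammer symbol `(q;q)_n`. -/
noncomputable def qPochhammer (q : ℂ) (n : ℕ) : ℂ :=
  ∏ j ∈ Finset.range n, (1 - q ^ (j + 1))

namespace qPochhammer

variable {q : ℂ}

@[simp] lemma zero : qPochhammer q 0 = 1 := by simp [qPochhammer]

lemma succ (n : ℕ) : qPochhammer q (n + 1) = qPochhammer q n * (1 - q ^ (n + 1)) :=
  Finset.prod_range_succ _ _

lemma one_sub_pow_ne_zero (hq : ‖q‖ < 1) (n : ℕ) : 1 - q ^ (n + 1) ≠ 0 := by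
  intro h
  have h1 : ‖q ^ (n + 1)‖ = 1 := by rw [← sub_eq_zero.mp h, norm_one]
  rw [norm_pow] at h1
  exact (pow_lt_one₀ (norm_nonneg q) hq n.succ_ne_zero).ne h1

lemma ne_zero (hq : ‖q‖ < 1) (n : ℕ) : qPochhammer q n ≠ 0 :=
  Finset.prod_ne_zero_iff.mpr fun j _ ↦ one_sub_pow_ne_zero hq j

lemma tendsto (hq : ‖q‖ < 1) :
    Tendsto (qPochhammer q) atTop (𝓝 (∏' j : ℕ, (1 - q ^ (j + 1)))) :=
  (ModularForm.multipliable_one_sub_pow hq).hasProd.tendsto_prod_nat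

lemma tprod_ne_zero (hq : ‖q‖ < 1) : ∏' j : ℕ, (1 - q ^ (j + 1)) ≠ 0 := by
  simp_rw [sub_eq_add_neg]
  refine tprod_one_add_ne_zero_of_summable (fun j ↦ ?_) ?_
  · simpa [sub_eq_add_neg] using one_sub_pow_ne_zero hq j
  · simpa using (summable_nat_add_iff 1).mpr (summable_geometric_of_lt_one (norm_nonneg q) hq)

lemma exists_norm_inv_le (hq : ‖q‖ < 1) : ∃ C, ∀ n, ‖(qPochhammer q n)⁻¹‖ ≤ C := by
  obtain ⟨C, hC⟩ := ((tendsto hq).inv₀ (tprod_ne_zero hq)).norm.bddAbove_range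
  exact ⟨C, fun n ↦ hC ⟨n, rfl⟩⟩

end qPochhammer

section PowerSeries

variable {c : ℕ → ℂ} {C : ℝ} {q x : ℂ}

lemma summable_mul_pow_of_bounded (hc : ∀ k, ‖c k‖ ≤ C) (hx : ‖x‖ < 1) :
    Summable fun k ↦ c k * x ^ k := by
  refine .of_norm_bounded ((summable_geometric_of_lt_one (norm_nonneg x) hx).mul_left C) fun k ↦ ?_
  rw [norm_mul, norm_pow]
  gcongr
  exact hc k

lemma tendsto_tsum_mul_pow_of_bounded (hc : ∀ k, ‖c k‖ ≤ C) (hq : ‖q‖ < 1) :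
    Tendsto (fun n : ℕ ↦ ∑' k, c k * (q ^ (n + 1)) ^ k) atTop (𝓝 (c 0)) := by
  have h0 : ∑' k, c k * (0 : ℂ) ^ k = c 0 := by
    rw [tsum_eq_single 0 fun k hk ↦ by simp [hk]]
    simp
  rw [← h0]
  refine tendsto_tsum_of_dominated_convergence
    ((summable_geometric_of_lt_one (norm_nonneg q) hq).mul_left C) (fun k ↦ ?_) ?_
  · exact (((tendsto_pow_atTop_nhds_zero_of_norm_lt_one hq).comp
      (tendsto_add_atTop_nat 1)).pow k).const_mul (c k)
  · refine .of_forall fun n k ↦ ?_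
    rw [norm_mul, norm_pow, norm_pow]
    have h1 : ‖q‖ ^ (n + 1) ≤ ‖q‖ := pow_le_of_le_one (norm_nonneg q) hq.le n.succ_ne_zero
    have hC : 0 ≤ C := (norm_nonneg _).trans (hc 0)
    gcongr
    exact hc k

lemma tsum_mul_pow_sub_tsum_mul_pow (hc : ∀ k, ‖c k‖ ≤ C) (hq : ‖q‖ < 1) (hx : ‖x‖ < 1) :
    ∑' k, c k * x ^ k - ∑' k, c k * (x * q) ^ k =
      x * ∑' k, c (k + 1) * (1 - q ^ (k + 1)) * x ^ k := by
  have hxq : ‖x * q‖ < 1 := by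
    rw [norm_mul]
    exact mul_lt_one_of_nonneg_of_lt_one_left (norm_nonneg x) hx hq.le
  have h₁ := summable_mul_pow_of_bounded hc hx
  have h₂ := summable_mul_pow_of_bounded hc hxq
  rw [← h₁.tsum_sub h₂, (h₁.sub h₂).tsum_eq_zero_add, ← tsum_mul_left]
  simp only [pow_zero, sub_self, zero_add]
  exact tsum_congr fun k ↦ by ring

end PowerSeries

section Euler

variable {q : ℂ}

lemma tprod_mul_tsum_pow_div_qPochhammer (hq : ‖q‖ < 1) (m : ℕ) :
    (∏' j : ℕ, (1 - q ^ (j + 1))) * ∑' k, (qPochhammer q k)⁻¹ * (q ^ (m + 1)) ^ k =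
      qPochhammer q m := by
  obtain ⟨C, hC⟩ := qPochhammer.exists_norm_inv_le hq
  set a : ℕ → ℂ := fun m ↦ ∑' k, (qPochhammer q k)⁻¹ * (q ^ (m + 1)) ^ k
  have hstep (n : ℕ) : a (n + 1) = a n * (1 - q ^ (n + 1)) := by
    have hx : ‖q ^ (n + 1)‖ < 1 := by
      rw [norm_pow]
      exact pow_lt_one₀ (norm_nonneg q) hq n.succ_ne_zero
    have h := tsum_mul_pow_sub_tsum_mul_pow hC hq hx
    have hc (k : ℕ) : (qPochhammer q (k + 1))⁻¹ * (1 - q ^ (k + 1)) = (qPochhammer q k)⁻¹ := by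
      have := qPochhammer.ne_zero hq k
      have := qPochhammer.one_sub_pow_ne_zero hq k
      rw [qPochhammer.succ]
      field_simp
    simp only [hc, ← pow_succ] at h
    linear_combination -h
  have hprod (n : ℕ) : a n = a 0 * qPochhammer q n := by
    induction n with
    | zero => simp
    | succ n ih => rw [hstep, ih, qPochhammer.succ]; ring
  have hlim : a 0 * ∏' j : ℕ, (1 - q ^ (j + 1)) = 1 := by
    refine tendsto_nhds_unique ((qPochhammer.tendsto hq).const_mul (a 0)) ?_
    simpa [← hprod] using tendsto_tsum_mul_pow_of_bounded hC hq
  change _ * a m = _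
  rw [hprod]
  linear_combination qPochhammer q m * hlim

lemma norm_euler_coeff_le {C : ℝ} (hq : ‖q‖ < 1) (hC : ∀ n, ‖(qPochhammer q n)⁻¹‖ ≤ C) (m : ℕ) :
    ‖(-1) ^ m * q ^ m.choose 2 * (qPochhammer q m)⁻¹‖ ≤ C := by
  rw [norm_mul, norm_mul, norm_pow, norm_neg, norm_one, one_pow, one_mul, norm_pow]
  exact (mul_le_of_le_one_left (norm_nonneg _) (pow_le_one₀ (norm_nonneg q) hq.le)).trans (hC m)

lemma qPochhammer_mul_tsum_euler (hq : ‖q‖ < 1) (k : ℕ) :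
    qPochhammer q k *
        ∑' m, (-1) ^ m * q ^ m.choose 2 * (qPochhammer q m)⁻¹ * (q ^ (k + 1)) ^ m =
      ∏' j : ℕ, (1 - q ^ (j + 1)) := by
  obtain ⟨C, hC⟩ := qPochhammer.exists_norm_inv_le hq
  have hB := norm_euler_coeff_le hq hC
  set b : ℕ → ℂ := fun k ↦
    ∑' m, (-1) ^ m * q ^ m.choose 2 * (qPochhammer q m)⁻¹ * (q ^ (k + 1)) ^ m
  have hstep (n : ℕ) : b n = (1 - q ^ (n + 1)) * b (n + 1) := by
    have hx : ‖q ^ (n + 1)‖ < 1 := by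
      rw [norm_pow]
      exact pow_lt_one₀ (norm_nonneg q) hq n.succ_ne_zero
    have h := tsum_mul_pow_sub_tsum_mul_pow hB hq hx
    have hc (m : ℕ) : (-1) ^ (m + 1) * q ^ (m + 1).choose 2 * (qPochhammer q (m + 1))⁻¹ *
        (1 - q ^ (m + 1)) * (q ^ (n + 1)) ^ m =
        -((-1) ^ m * q ^ m.choose 2 * (qPochhammer q m)⁻¹ * (q ^ (n + 1 + 1)) ^ m) := by
      have := qPochhammer.ne_zero hq m
      have := qPochhammer.one_sub_pow_ne_zero hq m
      rw [qPochhammer.succ, Nat.choose_succ_succ' m 1, Nat.choose_one_right]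
      field_simp
      ring
    simp only [hc, tsum_neg, ← pow_succ] at h
    linear_combination h
  have hprod (n : ℕ) : qPochhammer q n * b n = b 0 := by
    induction n with
    | zero => simp
    | succ n ih => rw [← ih, hstep n, qPochhammer.succ]; ring
  have hlim : (∏' j : ℕ, (1 - q ^ (j + 1))) * 1 = b 0 := by
    refine tendsto_nhds_unique ((qPochhammer.tendsto hq).mul
      (by simpa using tendsto_tsum_mul_pow_of_bounded hB hq)) ?_
    exact tendsto_const_nhds.congr fun n ↦ (hprod n).symm
  change _ * b k = _
  rw [hprod, ← hlim, mul_one]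

lemma tprod_sq_mul_tsum_eq_tsum_neg_one_pow (hq : ‖q‖ < 1) :
    (∏' j : ℕ, (1 - q ^ (j + 1))) ^ 2 * ∑' k, q ^ k / qPochhammer q k ^ 2 =
      ∑' m : ℕ, (-1) ^ m * q ^ (m + 1).choose 2 := by
  obtain ⟨C, hC⟩ := qPochhammer.exists_norm_inv_le hq
  have hC0 : 0 ≤ C := (norm_nonneg _).trans (hC 0)
  have hB := norm_euler_coeff_le hq hC
  set P := ∏' j : ℕ, (1 - q ^ (j + 1)) with hP
  let f (k m : ℕ) : ℂ := q ^ k * (qPochhammer q k)⁻¹ *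
    ((-1) ^ m * q ^ m.choose 2 * (qPochhammer q m)⁻¹ * (q ^ (k + 1)) ^ m)
  have hg := summable_geometric_of_lt_one (norm_nonneg q) hq
  have hf : Summable (Function.uncurry f) := by
    refine .of_norm_bounded (((hg.mul_left C).mul_of_nonneg (hg.mul_left C)
      (fun _ ↦ by positivity) (fun _ ↦ by positivity))) fun ⟨k, m⟩ ↦ ?_
    have hle : ‖(q ^ (k + 1)) ^ m‖ ≤ ‖q‖ ^ m := by
      rw [norm_pow, norm_pow]
      gcongr
      exact pow_le_of_le_one (norm_nonneg q) hq.le k.succ_ne_zero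
    change ‖q ^ k * _ * (_ * _)‖ ≤ C * ‖q‖ ^ k * (C * ‖q‖ ^ m)
    rw [norm_mul, norm_mul, norm_pow, norm_mul _ ((q ^ (k + 1)) ^ m), mul_comm C (‖q‖ ^ k)]
    gcongr
    · exact hC k
    · exact hB m
  have hrow (k : ℕ) : P * (q ^ k / qPochhammer q k ^ 2) = ∑' m, f k m := by
    have := qPochhammer.ne_zero hq k
    rw [tsum_mul_left, hP, ← qPochhammer_mul_tsum_euler hq k]
    field_simp
  have hcol (m : ℕ) : P * ∑' k, f k m = (-1) ^ m * q ^ (m + 1).choose 2 := by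
    have h0 := qPochhammer.ne_zero hq m
    have h (k : ℕ) : f k m = (-1) ^ m * q ^ (m + 1).choose 2 * (qPochhammer q m)⁻¹ *
        ((qPochhammer q k)⁻¹ * (q ^ (m + 1)) ^ k) := by
      simp only [f]
      rw [Nat.choose_succ_succ' m 1, Nat.choose_one_right]
      ring
    simp_rw [h]
    rw [tsum_mul_left, mul_left_comm, tprod_mul_tsum_pow_div_qPochhammer hq m,
      inv_mul_cancel_right₀ h0]
  rw [sq, mul_assoc, ← tsum_mul_left]
  simp_rw [hrow]
  rw [← hf.tsum_comm, ← tsum_mul_left]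
  exact tsum_congr hcol

lemma summable_neg_one_pow_mul_pow_choose (hq : ‖q‖ < 1) :
    Summable fun m : ℕ ↦ (-1) ^ m * q ^ (m + 1).choose 2 := by
  refine .of_norm_bounded (summable_geometric_of_lt_one (norm_nonneg q) hq) fun m ↦ ?_
  rw [norm_mul, norm_pow, norm_neg, norm_one, one_pow, one_mul, norm_pow]
  refine pow_le_pow_of_le_one (norm_nonneg q) hq.le ?_
  rw [Nat.choose_succ_succ' m 1, Nat.choose_one_right]
  exact Nat.le_add_right _ _

end Euler

/-- For every complex `q` with `|q| < 1`:
`∑_{r=0}^∞ q^{2r²+r} − ∑_{r=1}^∞ q^{2r²−r}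
  = ((q;q)_∞)² · ∑_{k=0}^∞ q^k / ((q;q)_k)²`.
The left-hand side is the false theta function `Ψ(q³,q)`; in the paper this
identity expresses the tail of the colored Jones polynomial of the negative
`(2,4)`-torus link in two ways. -/
theorem falseTheta_eq_doublePochhammer_sum (q : ℂ) (hq : ‖q‖ < 1) :
    (∑' r : ℕ, q ^ (2 * r ^ 2 + r)) -
        ∑' r : ℕ, q ^ (2 * (r + 1) ^ 2 - (r + 1)) =
      (∏' j : ℕ, (1 - q ^ (j + 1))) ^ 2 *
        ∑' k : ℕ, q ^ k / (∏ j ∈ Finset.range k, (1 - q ^ (j + 1))) ^ 2 := by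
  have hs := summable_neg_one_pow_mul_pow_choose hq
  have heven (r : ℕ) : (-1) ^ (2 * r) * q ^ (2 * r + 1).choose 2 = q ^ (2 * r ^ 2 + r) := by
    have h : (2 * r + 1).choose 2 = 2 * r ^ 2 + r := by
      rw [Nat.choose_two_right, Nat.add_sub_cancel]
      exact Nat.div_eq_of_eq_mul_left two_pos (by ring)
    simp [h, pow_mul]
  have hodd (r : ℕ) : (-1) ^ (2 * r + 1) * q ^ (2 * r + 1 + 1).choose 2 =
      -q ^ (2 * (r + 1) ^ 2 - (r + 1)) := by
    have h : (2 * r + 1 + 1).choose 2 = 2 * (r + 1) ^ 2 - (r + 1) := by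
      rw [Nat.choose_two_right, Nat.add_sub_cancel]
      refine Nat.div_eq_of_eq_mul_left two_pos ?_
      rw [Nat.sub_mul]
      exact (Nat.sub_eq_of_eq_add (by ring)).symm
    simp [h, pow_succ, pow_mul]
  have hsum_even : Summable fun r : ℕ ↦ (-1) ^ (2 * r) * q ^ (2 * r + 1).choose 2 :=
    hs.comp_injective (i := fun r ↦ 2 * r) fun a b h ↦ by simpa using h
  have hsum_odd : Summable fun r : ℕ ↦ (-1) ^ (2 * r + 1) * q ^ (2 * r + 1 + 1).choose 2 :=
    hs.comp_injective (i := fun r ↦ 2 * r + 1) fun a b h ↦ by simpa using h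
  have hsplit := tsum_even_add_odd (f := fun m : ℕ ↦ (-1) ^ m * q ^ (m + 1).choose 2)
    hsum_even hsum_odd
  simp only [heven, hodd, tsum_neg, ← sub_eq_add_neg] at hsplit
  rw [hsplit, ← tprod_sq_mul_tsum_eq_tsum_neg_one_pow hq]
  simp only [qPochhammer]
end

section
/- For every complex number q with |q| < 1 (equivalently, as an identity of formal power series in q): ∑_{r=0}^∞ q^{2r^2+r} − ∑_{r=1}^∞ q^{2r^2−r} = ∑_{k=0}^∞ (−1)^k q^{k(k+1)/2}. -/
/-- A power series with unit coefficients along exponents growing at least linearly converges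
inside the unit disc. -/
theorem summable_pow_of_le {q : ℂ} (hq : ‖q‖ < 1) {e : ℕ → ℕ} (he : ∀ r, r ≤ e r) :
    Summable fun r => q ^ e r := by
  refine .of_norm_bounded (summable_geometric_of_lt_one (norm_nonneg q) hq) fun r => ?_
  rw [norm_pow]
  exact pow_le_pow_of_le_one (norm_nonneg q) hq.le (he r)

/-- For every complex `q` with `|q| < 1`:
`∑_{r=0}^∞ q^{2r²+r} − ∑_{r=1}^∞ q^{2r²−r} = ∑_{k=0}^∞ (−1)^k q^{k(k+1)/2}`.
The left-hand side is the false theta function `Ψ(q³,q)`, the right-hand side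
the alternating sum over triangular-number exponents. -/
theorem falseTheta_eq_alternating_triangular (q : ℂ) (hq : ‖q‖ < 1) :
    (∑' r : ℕ, q ^ (2 * r ^ 2 + r)) -
        ∑' r : ℕ, q ^ (2 * (r + 1) ^ 2 - (r + 1)) =
      ∑' k : ℕ, (-1 : ℂ) ^ k * q ^ (k * (k + 1) / 2) := by
  have hodd_exp (r : ℕ) : 2 * (r + 1) ^ 2 - (r + 1) = 2 * r ^ 2 + 3 * r + 1 :=
    Nat.sub_eq_of_eq_add (by ring)
  have heven (r : ℕ) : (-1 : ℂ) ^ (2 * r) * q ^ (2 * r * (2 * r + 1) / 2) =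
      q ^ (2 * r ^ 2 + r) := by
    rw [(even_two_mul r).neg_one_pow, one_mul,
      Nat.div_eq_of_eq_mul_right two_pos (by ring : _ = 2 * (2 * r ^ 2 + r))]
  have hodd (r : ℕ) : (-1 : ℂ) ^ (2 * r + 1) * q ^ ((2 * r + 1) * (2 * r + 1 + 1) / 2) =
      -q ^ (2 * (r + 1) ^ 2 - (r + 1)) := by
    rw [(odd_two_mul_add_one r).neg_one_pow, neg_one_mul, hodd_exp,
      Nat.div_eq_of_eq_mul_right two_pos (by ring : _ = 2 * (2 * r ^ 2 + 3 * r + 1))]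
  have hsum_even : Summable fun r : ℕ => q ^ (2 * r ^ 2 + r) :=
    summable_pow_of_le hq fun r => Nat.le_add_left _ _
  have hsum_odd : Summable fun r : ℕ => q ^ (2 * (r + 1) ^ 2 - (r + 1)) :=
    summable_pow_of_le hq fun r => by rw [hodd_exp]; lia
  rw [← tsum_even_add_odd (f := fun k : ℕ => (-1 : ℂ) ^ k * q ^ (k * (k + 1) / 2))
    (by simpa only [heven] using hsum_even)
    (by simpa only [hodd] using hsum_odd.neg)]
  simp only [heven, hodd, tsum_neg, sub_eq_add_neg]
end

section
/- (Euler's pentagonal number theorem, in the form f(−q^2,−q) = (q;q)_∞.) For every complex number q with |q| < 1 (equivalently, as an identity of formal power series in q): ∑_{m∈ℤ} (−1)^m q^{m(3m+1)/2} = ∏_{n=1}^∞ (1 − q^n). -/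
open Filter Topology

/-- The partial products of `∏ (1 - q ^ (k + i + 1))` are bounded uniformly in `k`. -/
theorem norm_prod_one_sub_pow_le {q : ℂ} (hq : ‖q‖ < 1) (k n : ℕ) :
    ‖∏ i ∈ Finset.range n, (1 - q ^ (k + i + 1))‖ ≤ Real.exp (1 - ‖q‖)⁻¹ := by
  rw [norm_prod]
  calc ∏ i ∈ Finset.range n, ‖1 - q ^ (k + i + 1)‖
      ≤ ∏ i ∈ Finset.range n, (1 + ‖q‖ ^ i) := by
        refine Finset.prod_le_prod (fun _ _ ↦ norm_nonneg _) fun i _ ↦ ?_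
        refine (norm_sub_le _ _).trans ?_
        rw [norm_one, norm_pow]
        gcongr 1 + ?_
        exact pow_le_pow_of_le_one (norm_nonneg _) hq.le (by lia)
    _ ≤ Real.exp (∑ i ∈ Finset.range n, ‖q‖ ^ i) :=
        Real.prod_one_add_le_exp_sum _ fun _ ↦ by positivity
    _ ≤ Real.exp (1 - ‖q‖)⁻¹ := by
        gcongr
        rw [← tsum_geometric_of_lt_one (norm_nonneg _) hq]
        exact (summable_geometric_of_lt_one (norm_nonneg _) hq).sum_le_tsum _
          fun _ _ ↦ by positivity

theorem norm_pow_mul_prod_one_sub_pow_le {q : ℂ} (hq : ‖q‖ < 1) (k n : ℕ) :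
    ‖q ^ ((k + 1) * n) * ∏ i ∈ Finset.range (n + 1), (1 - q ^ (k + i + 1))‖ ≤
      ‖q‖ ^ n * Real.exp (1 - ‖q‖)⁻¹ := by
  rw [norm_mul, norm_pow]
  exact mul_le_mul
    (pow_le_pow_of_le_one (norm_nonneg _) hq.le (Nat.le_mul_of_pos_left n k.succ_pos))
    (norm_prod_one_sub_pow_le hq k (n + 1)) (norm_nonneg _) (by positivity)

theorem summable_neg_one_zpow_mul_pow_pentagonal_neg {q : ℂ} (hq : ‖q‖ < 1) :
    Summable fun m : ℤ ↦ (-1 : ℂ) ^ m * q ^ pentagonal (-m) := by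
  refine .of_norm ?_
  simpa [Function.comp_def] using (summable_norm_geometric_of_norm_lt_one hq).comp_injective
    (pentagonal_injective.comp neg_injective)

theorem hasSum_neg_one_pow_mul_pow_pentagonal_sub {q : ℂ} (hq : ‖q‖ < 1) :
    HasSum (fun k : ℕ ↦ (-1) ^ k * (q ^ pentagonal (-k) - q ^ pentagonal (k + 1)))
      (∑' m : ℤ, (-1 : ℂ) ^ m * q ^ pentagonal (-m)) := by
  convert (summable_neg_one_zpow_mul_pow_pentagonal_neg hq).hasSum.nat_add_neg_add_one using 2
    with k
  have h : (-1 : ℂ) ^ (-((k : ℤ) + 1)) = -(-1) ^ k := by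
    rw [zpow_neg, ← inv_zpow, inv_neg_one, zpow_add_one₀ (by simp)]
    simp
  rw [h, neg_neg, zpow_natCast]
  ring

theorem tprod_one_sub_pow_eq_tsum_pentagonal {q : ℂ} (hq : ‖q‖ < 1) :
    ∏' n : ℕ, (1 - q ^ (n + 1)) =
      ∑' k : ℕ, (-1) ^ k * (q ^ pentagonal (-k) - q ^ pentagonal (k + 1)) := by
  have hgeom : Summable fun n : ℕ ↦ ‖q‖ ^ n * Real.exp (1 - ‖q‖)⁻¹ :=
    (summable_geometric_of_lt_one (norm_nonneg _) hq).mul_right _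
  refine Pentagonal.tprod_one_sub_pow (tendsto_pow_atTop_nhds_zero_of_norm_lt_one hq)
    (fun k ↦ .of_norm_bounded hgeom (norm_pow_mul_prod_one_sub_pow_le hq k)) (fun k ↦ ?_)
    (hasSum_neg_one_pow_mul_pow_pentagonal_sub hq).summable ?_
  · simp_rw [sub_eq_add_neg]
    refine multipliable_one_add_of_summable ?_
    simpa [add_assoc] using (summable_nat_add_iff (k + 1)).2
      (summable_geometric_of_lt_one (norm_nonneg q) hq)
  · have hlim : Tendsto (fun k : ℕ ↦ ‖q‖ ^ k * ∑' n : ℕ, ‖q‖ ^ n * Real.exp (1 - ‖q‖)⁻¹)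
        atTop (𝓝 0) := by
      simpa using (tendsto_pow_atTop_nhds_zero_of_lt_one (norm_nonneg q) hq).mul_const
        (∑' n : ℕ, ‖q‖ ^ n * Real.exp (1 - ‖q‖)⁻¹)
    refine squeeze_zero_norm (fun k ↦ ?_) hlim
    rw [norm_mul, norm_mul, norm_pow, norm_neg, norm_one, one_pow, one_mul, norm_pow]
    refine mul_le_mul (pow_le_pow_of_le_one (norm_nonneg _) hq.le ?_)
      (tsum_of_norm_bounded hgeom.hasSum (norm_pow_mul_prod_one_sub_pow_le hq k))
      (norm_nonneg _) (by positivity)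
    rw [Nat.le_div_iff_mul_le two_pos]
    nlinarith

/-- **Euler's pentagonal number theorem**, in the form `f(−q²,−q) = (q;q)_∞`:
for every complex `q` with `|q| < 1`,
`∑_{m∈ℤ} (−1)^m q^{m(3m+1)/2} = ∏_{n=1}^∞ (1−q^n)`. -/
theorem pentagonal_number_theorem (q : ℂ) (hq : ‖q‖ < 1) :
    ∑' m : ℤ, (-1 : ℂ) ^ m * q ^ (m * (3 * m + 1) / 2) =
      ∏' n : ℕ, (1 - q ^ (n + 1)) := by
  have h (m : ℤ) : m * (3 * m + 1) / 2 = (pentagonal (-m) : ℤ) := by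
    rw [← two_mul_natCast_pentagonal_neg, Int.mul_ediv_cancel_left _ two_ne_zero]
  simp_rw [h, zpow_natCast]
  rw [tprod_one_sub_pow_eq_tsum_pentagonal hq,
    (hasSum_neg_one_pow_mul_pow_pentagonal_sub hq).tsum_eq]
end
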